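/- Let {ρ_n} ⊂ T_+(H) be a sequence converging in trace norm to a faithful state ρ₀ ∈ S(H), and let {A_n} be a sequence of operators in the unit ball of B(H) such that A_n ρ_n A_n* converges in trace norm to some σ₀ ∈ T_+(H). Then the sequence {A_n} is relatively compact in the strong operator topology, and every partial limit A₀ of {A_n} satisfies A₀ ρ₀ A₀* = σ₀. -/

import Mathlib

open Filter Topology ContinuousLinearMap
open scoped ComplexOrder

noncomputable section

notation "⟪" x ", " y "⟫" => @inner ℂ _ _ x y

section Defs

variable {H K : Type*} [NormedAddCommGroup H] [InnerProductSpace ℂ H] [CompleteSpace H]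
  [NormedAddCommGroup K] [InnerProductSpace ℂ K] [CompleteSpace K]

/-- The rank-one operator `|y⟩⟨z|`. -/
def rankOne (y : K) (z : H) : H →L[ℂ] K :=
  (ContinuousLinearMap.toSpanSingleton ℂ y).comp (innerSL ℂ z)

/-- `A` is a trace-class operator (equivalently, nuclear operator). -/
def IsTC (A : H →L[ℂ] K) : Prop :=
  ∃ f : ℕ → K, ∃ g : ℕ → H, Summable (fun n => ‖f n‖ * ‖g n‖) ∧
    ∀ x : H, HasSum (fun n => ⟪g n, x⟫ • f n) (A x)

/-- The trace of an operator, computed in a Hilbert basis. -/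
def trC {ι : Type*} (e : HilbertBasis ι ℂ H) (A : H →L[ℂ] H) : ℂ :=
  ∑' i, ⟪e i, A (e i)⟫

/-- The trace norm `‖A‖₁ = sup {|Tr (B A)| : ‖B‖ ≤ 1}`. -/
def tnorm {ι : Type*} (e : HilbertBasis ι ℂ H) (A : H →L[ℂ] H) : ℝ :=
  sSup { r : ℝ | ∃ B : H →L[ℂ] H, ‖B‖ ≤ 1 ∧ r = ‖trC e (B ∘L A)‖ }

/-- Membership in the positive cone `T₊(H)` of trace-class operators. -/
def IsPTC (ρ : H →L[ℂ] H) : Prop := ρ.IsPositive ∧ IsTC ρ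

/-- `ρ` is a state (a positive trace-class operator of unit trace). -/
def IsState {ι : Type*} (e : HilbertBasis ι ℂ H) (ρ : H →L[ℂ] H) : Prop :=
  ρ.IsPositive ∧ IsTC ρ ∧ trC e ρ = 1

/-- `ρ` is a faithful state (a state with trivial kernel). -/
def IsFaithfulState {ι : Type*} (e : HilbertBasis ι ℂ H) (ρ : H →L[ℂ] H) : Prop :=
  IsState e ρ ∧ ∀ x, ρ x = 0 → x = 0

/-- The Loewner operator order. -/
def OpLE (A B : H →L[ℂ] H) : Prop := (B - A).IsPositive

/-- `S` is the least upper bound of the sequence `A` in the Loewner order. -/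
def IsLUBOp (A : ℕ → H →L[ℂ] H) (S : H →L[ℂ] H) : Prop :=
  (∀ m, OpLE (A m) S) ∧ ∀ C, (∀ m, OpLE (A m) C) → OpLE S C

/-- A quantum operation from `A` to `B`: a completely positive trace-non-increasing
linear map from `T(H_A)` to `T(H_B)`. -/
structure QOp (eA : HilbertBasis ℕ ℂ H) (eB : HilbertBasis ℕ ℂ K) where
  toFun : (H →L[ℂ] H) → (K →L[ℂ] K)
  map_add' : ∀ ρ σ : H →L[ℂ] H, IsTC ρ → IsTC σ → toFun (ρ + σ) = toFun ρ + toFun σ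
  map_smul' : ∀ (c : ℂ) (ρ : H →L[ℂ] H), IsTC ρ → toFun (c • ρ) = c • toFun ρ
  maps_tc' : ∀ ρ : H →L[ℂ] H, IsTC ρ → IsTC (toFun ρ)
  completely_pos' : ∀ (n : ℕ) (y : Fin n → H) (x : Fin n → K),
    0 ≤ ∑ i, ∑ j, ⟪x i, toFun (rankOne (y i) (y j)) (x j)⟫
  trace_nonincreasing' : ∀ ρ : H →L[ℂ] H, ρ.IsPositive → IsTC ρ →
    (trC eB (toFun ρ)).re ≤ (trC eA ρ).re

variable {eA : HilbertBasis ℕ ℂ H} {eB : HilbertBasis ℕ ℂ K}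

/-- A quantum channel is a trace-preserving quantum operation. -/
def IsChannel (Φ : QOp eA eB) : Prop :=
  ∀ ρ : H →L[ℂ] H, ρ.IsPositive → IsTC ρ → trC eB (Φ.toFun ρ) = trC eA ρ

/-- Convergence in the trace norm. -/
def TNConv {ι : Type*} (e : HilbertBasis ι ℂ K) (a : ℕ → K →L[ℂ] K) (L : K →L[ℂ] K) : Prop :=
  Tendsto (fun n => tnorm e (a n - L)) atTop (nhds 0)

/-- Strong convergence of a sequence of quantum operations. -/
def StrongConv (Φn : ℕ → QOp eA eB) (Φ : QOp eA eB) : Prop :=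
  ∀ ρ : H →L[ℂ] H, IsState eA ρ → TNConv eB (fun n => (Φn n).toFun ρ) (Φ.toFun ρ)

/-- Relative (sequential) compactness in the strong convergence topology. -/
def QRelCompact (F : Set (QOp eA eB)) : Prop :=
  ∀ Φs : ℕ → QOp eA eB, (∀ n, Φs n ∈ F) →
    ∃ (k : ℕ → ℕ) (Φ₀ : QOp eA eB), StrictMono k ∧ StrongConv (fun n => Φs (k n)) Φ₀

/-- Relative (sequential) compactness within the set of quantum channels. -/
def QRelCompactCh (F : Set (QOp eA eB)) : Prop :=
  ∀ Φs : ℕ → QOp eA eB, (∀ n, Φs n ∈ F) →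
    ∃ (k : ℕ → ℕ) (Φ₀ : QOp eA eB), StrictMono k ∧ IsChannel Φ₀ ∧
      StrongConv (fun n => Φs (k n)) Φ₀

/-- (Sequential) compactness in the strong convergence topology. -/
def QSeqCompact (F : Set (QOp eA eB)) : Prop :=
  ∀ Φs : ℕ → QOp eA eB, (∀ n, Φs n ∈ F) →
    ∃ (k : ℕ → ℕ) (Φ₀ : QOp eA eB), StrictMono k ∧ Φ₀ ∈ F ∧
      StrongConv (fun n => Φs (k n)) Φ₀

/-- (Sequential) closedness in the strong convergence topology. -/
def QSeqClosed (F : Set (QOp eA eB)) : Prop :=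
  ∀ (Φs : ℕ → QOp eA eB) (Φ₀ : QOp eA eB), (∀ n, Φs n ∈ F) → StrongConv Φs Φ₀ → Φ₀ ∈ F

/-- (Sequential) compactness of a set of operators in the trace norm. -/
def TNSeqCompact {ι : Type*} (e : HilbertBasis ι ℂ K) (S : Set (K →L[ℂ] K)) : Prop :=
  ∀ a : ℕ → K →L[ℂ] K, (∀ n, a n ∈ S) →
    ∃ (k : ℕ → ℕ) (L : K →L[ℂ] K), StrictMono k ∧ L ∈ S ∧ TNConv e (fun n => a (k n)) L

/-- Relative (sequential) compactness of `S` within the ambient set `T`, in the trace norm. -/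
def TNRelCompactIn {ι : Type*} (e : HilbertBasis ι ℂ K) (T S : Set (K →L[ℂ] K)) : Prop :=
  ∀ a : ℕ → K →L[ℂ] K, (∀ n, a n ∈ S) →
    ∃ (k : ℕ → ℕ) (L : K →L[ℂ] K), StrictMono k ∧ L ∈ T ∧ TNConv e (fun n => a (k n)) L

/-- `A` is a Kraus representation of `Φ`. -/
def KrausRep (Φ : QOp eA eB) (A : ℕ → H →L[ℂ] K) : Prop :=
  ∀ ρ : H →L[ℂ] H, IsTC ρ →
    HasSum (fun n => A n ∘L ρ ∘L (ContinuousLinearMap.adjoint (A n))) (Φ.toFun ρ)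

/-- The Choi rank of a quantum operation: the minimal number of Kraus operators. -/
def ChoiRank (Φ : QOp eA eB) : ℕ∞ :=
  sInf { n : ℕ∞ | ∃ A : ℕ → H →L[ℂ] K, (∀ i : ℕ, n ≤ (i : ℕ∞) → A i = 0) ∧ KrausRep Φ A }

/-- Convergence in the strong operator topology. -/
def SOTConv (a : ℕ → H →L[ℂ] K) (A : H →L[ℂ] K) : Prop :=
  ∀ x : H, Tendsto (fun n => a n x) atTop (nhds (A x))

/-- Relative (sequential) compactness in the strong operator topology. -/
def SOTRelCompact (S : Set (H →L[ℂ] K)) : Prop :=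
  ∀ a : ℕ → H →L[ℂ] K, (∀ n, a n ∈ S) →
    ∃ (k : ℕ → ℕ) (A : H →L[ℂ] K), StrictMono k ∧ SOTConv (fun n => a (k n)) A

/-- (Sequential) compactness in the strong operator topology. -/
def SOTSeqCompact (S : Set (H →L[ℂ] K)) : Prop :=
  ∀ a : ℕ → H →L[ℂ] K, (∀ n, a n ∈ S) →
    ∃ (k : ℕ → ℕ) (A : H →L[ℂ] K), StrictMono k ∧ A ∈ S ∧ SOTConv (fun n => a (k n)) A

/-- A finite-rank orthogonal projection. -/
def IsFinRankProj (P : K →L[ℂ] K) : Prop :=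
  IsSelfAdjoint P ∧ P ∘L P = P ∧ FiniteDimensional ℂ (LinearMap.range (P : K →ₗ[ℂ] K))

end Defs

section Tensor

variable {H K W : Type*} [NormedAddCommGroup H] [InnerProductSpace ℂ H] [CompleteSpace H]
  [NormedAddCommGroup K] [InnerProductSpace ℂ K] [CompleteSpace K]
  [NormedAddCommGroup W] [InnerProductSpace ℂ W] [CompleteSpace W]

/-- A realization of `W` as the Hilbert tensor product `H ⊗ K`. -/
structure TensorStruct (H K W : Type*) [NormedAddCommGroup H] [InnerProductSpace ℂ H]
    [NormedAddCommGroup K] [InnerProductSpace ℂ K]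
    [NormedAddCommGroup W] [InnerProductSpace ℂ W] where
  mul : H → K → W
  inner_mul : ∀ (x x' : H) (y y' : K), ⟪mul x y, mul x' y'⟫ = ⟪x, x'⟫ * ⟪y, y'⟫
  dense_span : Dense (↑(Submodule.span ℂ {w : W | ∃ x y, w = mul x y}) : Set W)

/-- `Z = X ⊗ Y` relative to the tensor realization `T`. -/
def IsTensorOp (T : TensorStruct H K W) (X : H →L[ℂ] H) (Y : K →L[ℂ] K)
    (Z : W →L[ℂ] W) : Prop :=
  ∀ x y, Z (T.mul x y) = T.mul (X x) (Y y)

/-- `b = Tr_K ω`, the left partial trace, characterized by duality. -/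
def IsLeftMarginal (T : TensorStruct H K W) {ι κ : Type*} (eH : HilbertBasis ι ℂ H)
    (eW : HilbertBasis κ ℂ W) (ω : W →L[ℂ] W) (b : H →L[ℂ] H) : Prop :=
  ∀ (X : H →L[ℂ] H) (Z : W →L[ℂ] W), IsTensorOp T X 1 Z →
    trC eH (b ∘L X) = trC eW (ω ∘L Z)

/-- `c = Tr_H ω`, the right partial trace, characterized by duality. -/
def IsRightMarginal (T : TensorStruct H K W) {ι κ : Type*} (eK : HilbertBasis ι ℂ K)
    (eW : HilbertBasis κ ℂ W) (ω : W →L[ℂ] W) (c : K →L[ℂ] K) : Prop :=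
  ∀ (Y : K →L[ℂ] K) (Z : W →L[ℂ] W), IsTensorOp T 1 Y Z →
    trC eK (c ∘L Y) = trC eW (ω ∘L Z)

end Tensor

section TraceEstimates

variable {ι H K : Type*} [NormedAddCommGroup H] [InnerProductSpace ℂ H]
  [NormedAddCommGroup K] [InnerProductSpace ℂ K]

/-- The Cauchy–Schwarz inequality for the semi-inner product of a positive operator. -/
theorem ContinuousLinearMap.IsPositive.norm_inner_apply_sq_le {T : H →L[ℂ] H}
    (hT : T.IsPositive) (x y : H) :
    ‖⟪x, T y⟫‖ ^ 2 ≤ (⟪x, T x⟫).re * (⟪y, T y⟫).re := by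
  let core : PreInnerProductSpace.Core ℂ H :=
    { inner := fun x y => ⟪x, T y⟫
      conj_inner_symm := fun x y => by
        rw [inner_conj_symm, hT.inner_left_eq_inner_right]
      re_inner_nonneg := fun x => hT.re_inner_nonneg_right x
      add_left := fun x y z => inner_add_left _ _ _
      smul_left := fun x y r => inner_smul_left _ _ _ }
  have h := @InnerProductSpace.Core.inner_mul_inner_self_le ℂ H _ _ _ core x y
  change ‖⟪x, T y⟫‖ * ‖⟪y, T x⟫‖ ≤ (⟪x, T x⟫).re * (⟪y, T y⟫).re at h
  rwa [← hT.inner_left_eq_inner_right y x, norm_inner_symm (T y) x, ← sq] at h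

/-- Finite diagonal sums of `B D` are bounded uniformly over contractions `B`. -/
def TraceBounded (e : HilbertBasis ι ℂ H) (D : H →L[ℂ] H) : Prop :=
  ∃ C : ℝ, ∀ B : H →L[ℂ] H, ‖B‖ ≤ 1 → ∀ s : Finset ι, ∑ i ∈ s, ‖⟪e i, B (D (e i))⟫‖ ≤ C

theorem Orthonormal.sum_norm_inner_mul_le {v : ι → H} (hv : Orthonormal ℂ v) (s : Finset ι)
    (x y : H) : ∑ i ∈ s, ‖⟪x, v i⟫‖ * ‖⟪v i, y⟫‖ ≤ ‖x‖ * ‖y‖ := by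
  refine (Real.sum_mul_le_sqrt_mul_sqrt s _ _).trans ?_
  have h (z : H) : √(∑ i ∈ s, ‖⟪v i, z⟫‖ ^ 2) ≤ ‖z‖ :=
    Real.sqrt_le_iff.2 ⟨norm_nonneg z, hv.sum_inner_products_le z⟩
  have hx := h x
  simp only [norm_inner_symm _ x] at hx
  exact mul_le_mul hx (h y) (Real.sqrt_nonneg _) (norm_nonneg _)

theorem TraceBounded.sub {e : HilbertBasis ι ℂ H} {D E : H →L[ℂ] H} (hD : TraceBounded e D)
    (hE : TraceBounded e E) : TraceBounded e (D - E) := by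
  obtain ⟨C, hC⟩ := hD
  obtain ⟨C', hC'⟩ := hE
  refine ⟨C + C', fun B hB s => (Finset.sum_le_sum fun i _ => ?_).trans
    (Finset.sum_add_distrib.trans_le (add_le_add (hC B hB s) (hC' B hB s)))⟩
  simpa only [sub_apply, map_sub, inner_sub_right] using norm_sub_le _ _

theorem TraceBounded.summable_norm {e : HilbertBasis ι ℂ H} {D : H →L[ℂ] H}
    (hD : TraceBounded e D) {B : H →L[ℂ] H} (hB : ‖B‖ ≤ 1) :
    Summable fun i => ‖⟪e i, B (D (e i))⟫‖ := by
  obtain ⟨C, hC⟩ := hD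
  exact summable_of_sum_le (fun i => norm_nonneg _) (hC B hB)

theorem norm_rankOne_le (y : K) (x : H) : ‖rankOne y x‖ ≤ ‖y‖ * ‖x‖ := by
  refine (opNorm_comp_le _ _).trans ?_
  simp

theorem IsTC.traceBounded {D : H →L[ℂ] H} (hD : IsTC D) (e : HilbertBasis ι ℂ H) :
    TraceBounded e D := by
  obtain ⟨f, g, hs, h⟩ := hD
  refine ⟨∑' n, ‖f n‖ * ‖g n‖, fun B hB s => ?_⟩
  have hBf (n : ℕ) : ‖B (f n)‖ ≤ ‖f n‖ := by simpa using B.le_of_opNorm_le hB (f n)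
  have hterm (i : ι) : Summable fun n => ‖⟪g n, e i⟫‖ * ‖⟪e i, B (f n)⟫‖ := by
    refine hs.of_nonneg_of_le (fun n => by positivity) fun n => ?_
    rw [mul_comm]
    have h1 := norm_inner_le_norm (𝕜 := ℂ) (e i) (B (f n))
    have h2 := norm_inner_le_norm (𝕜 := ℂ) (g n) (e i)
    rw [e.orthonormal.norm_eq_one] at h1 h2
    exact mul_le_mul (by linarith [hBf n]) (by linarith) (norm_nonneg _) (norm_nonneg _)
  calc ∑ i ∈ s, ‖⟪e i, B (D (e i))⟫‖
      ≤ ∑ i ∈ s, ∑' n, ‖⟪g n, e i⟫‖ * ‖⟪e i, B (f n)⟫‖ := by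
        refine Finset.sum_le_sum fun i _ => ?_
        have hsum := (innerSL ℂ (e i)).hasSum (B.hasSum (h (e i)))
        simp only [map_smul, innerSL_apply_apply, smul_eq_mul] at hsum
        rw [← hsum.tsum_eq]
        refine (norm_tsum_le_tsum_norm ?_).trans_eq ?_
        · simpa only [norm_mul] using hterm i
        · simp only [norm_mul]
    _ = ∑' n, ∑ i ∈ s, ‖⟪g n, e i⟫‖ * ‖⟪e i, B (f n)⟫‖ :=
        (Summable.tsum_finsetSum fun i _ => hterm i).symm
    _ ≤ ∑' n, ‖f n‖ * ‖g n‖ := by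
        refine Summable.tsum_le_tsum (fun n => ?_) (summable_sum fun i _ => hterm i) hs
        refine (e.orthonormal.sum_norm_inner_mul_le s _ _).trans ?_
        rw [mul_comm]
        exact mul_le_mul_of_nonneg_right (hBf n) (norm_nonneg _)

theorem TraceBounded.norm_trC_le {e : HilbertBasis ι ℂ H} {D : H →L[ℂ] H}
    (hD : TraceBounded e D) {B : H →L[ℂ] H} (hB : ‖B‖ ≤ 1) :
    ‖trC e (B ∘L D)‖ ≤ tnorm e D := by
  refine le_csSup ?_ ⟨B, hB, rfl⟩
  obtain ⟨C, hC⟩ := id hD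
  refine ⟨C, ?_⟩
  rintro _ ⟨B, hB, rfl⟩
  exact (norm_tsum_le_tsum_norm (hD.summable_norm hB)).trans
    ((hD.summable_norm hB).tsum_le_of_sum_le (hC B hB))

variable [CompleteSpace H] [CompleteSpace K]

theorem trC_rankOne_comp (e : HilbertBasis ι ℂ H) (D : H →L[ℂ] H) (x y : H) :
    trC e (rankOne y x ∘L D) = ⟪x, D y⟫ := by
  rw [← adjoint_inner_left, ← e.tsum_inner_mul_inner]
  refine tsum_congr fun i => ?_
  simp [rankOne, adjoint_inner_left]

theorem TraceBounded.norm_inner_le {e : HilbertBasis ι ℂ H} {D : H →L[ℂ] H}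
    (hD : TraceBounded e D) (x y : H) : ‖⟪x, D y⟫‖ ≤ tnorm e D * (‖x‖ * ‖y‖) := by
  rcases eq_or_ne x 0 with rfl | hx
  · simp
  rcases eq_or_ne y 0 with rfl | hy
  · simp
  have hx' := norm_pos_iff.2 hx
  have hy' := norm_pos_iff.2 hy
  set r : ℝ := ‖x‖ * ‖y‖ with hr
  have hr0 : 0 < r := by positivity
  have hB : ‖((r⁻¹ : ℝ) : ℂ) • rankOne y x‖ ≤ 1 := by
    rw [norm_smul, Complex.norm_real, Real.norm_of_nonneg (by positivity), inv_mul_le_one₀ hr0]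
    exact (norm_rankOne_le y x).trans_eq (mul_comm _ _)
  have h := hD.norm_trC_le hB
  have htr : trC e ((((r⁻¹ : ℝ) : ℂ) • rankOne y x) ∘L D) = ((r⁻¹ : ℝ) : ℂ) * ⟪x, D y⟫ := by
    rw [← trC_rankOne_comp e, trC, trC, ← tsum_mul_left]
    simp
  rw [htr, norm_mul, Complex.norm_real, Real.norm_of_nonneg (by positivity),
    inv_mul_le_iff₀ hr0] at h
  linarith

theorem TraceBounded.norm_apply_le {e : HilbertBasis ι ℂ H} {D : H →L[ℂ] H}
    (hD : TraceBounded e D) (y : H) : ‖D y‖ ≤ tnorm e D * ‖y‖ := by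
  rcases eq_or_ne (D y) 0 with h0 | h0
  · have h := (norm_nonneg _).trans (hD.norm_trC_le (B := 0) (by simp))
    rw [h0, norm_zero]
    positivity
  · have h := hD.norm_inner_le (D y) y
    rw [inner_self_eq_norm_sq_to_K, norm_pow, RCLike.norm_ofReal, abs_norm, sq] at h
    have h0' := norm_pos_iff.2 h0
    refine le_of_mul_le_mul_right ?_ h0'
    linarith

theorem IsTC.conj {ρ : H →L[ℂ] H} (hρ : IsTC ρ) (A : H →L[ℂ] K) :
    IsTC (A ∘L ρ ∘L adjoint A) := by
  obtain ⟨f, g, hs, h⟩ := hρ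
  refine ⟨fun n => A (f n), fun n => A (g n), ?_, fun x => ?_⟩
  · refine (hs.mul_left (‖A‖ * ‖A‖)).of_nonneg_of_le (fun n => by positivity) fun n => ?_
    calc ‖A (f n)‖ * ‖A (g n)‖ ≤ (‖A‖ * ‖f n‖) * (‖A‖ * ‖g n‖) :=
          mul_le_mul (A.le_opNorm _) (A.le_opNorm _) (norm_nonneg _) (by positivity)
      _ = _ := by ring
  · simpa [adjoint_inner_right] using A.hasSum (h (adjoint A x))

/-- The orthogonal projection onto the complement of the first `N` basis vectors. -/
def tailProj (e : HilbertBasis ℕ ℂ H) (N : ℕ) : H →L[ℂ] H :=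
  (Submodule.span ℂ (e '' Set.Iio N))ᗮ.starProjection

theorem norm_tailProj_le (e : HilbertBasis ℕ ℂ H) (N : ℕ) : ‖tailProj e N‖ ≤ 1 :=
  Submodule.starProjection_norm_le _

theorem inner_tailProj (e : HilbertBasis ℕ ℂ H) (N i : ℕ) (v : H) :
    ⟪e i, tailProj e N v⟫ = if i < N then 0 else ⟪e i, v⟫ := by
  rw [tailProj, ← Submodule.inner_starProjection_left_eq_right]
  split_ifs with h
  · rw [Submodule.starProjection_orthogonal_apply_eq_zero, inner_zero_left]
    exact Submodule.subset_span ⟨i, h, rfl⟩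
  · rw [Submodule.starProjection_eq_self_iff.2]
    refine (Submodule.mem_orthogonal _ _).2 fun u hu => ?_
    induction hu using Submodule.span_induction with
    | mem x hx =>
      obtain ⟨j, hj, rfl⟩ := hx
      exact e.orthonormal.2 fun hji => h (hji ▸ hj)
    | zero => simp
    | add x y _ _ hx hy => rw [inner_add_left, hx, hy, add_zero]
    | smul a x _ hx => rw [inner_smul_left, hx, mul_zero]

theorem TraceBounded.tendsto_trC_tailProj {e : HilbertBasis ℕ ℂ H} {D : H →L[ℂ] H}
    (hD : TraceBounded e D) :
    Tendsto (fun N => ‖trC e (tailProj e N ∘L D)‖) atTop (𝓝 0) := by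
  have hs := hD.summable_norm (B := 1) norm_id_le
  have h := tendsto_tsum_of_dominated_convergence (𝓕 := atTop)
    (f := fun N i => ⟪e i, tailProj e N (D (e i))⟫) (g := fun _ => (0 : ℂ)) hs
    (fun i => tendsto_const_nhds.congr' <| by
      filter_upwards [eventually_gt_atTop i] with N hN
      rw [inner_tailProj, if_pos hN])
    (Eventually.of_forall fun N i => by
      rw [inner_tailProj]
      split_ifs <;> simp)
  rw [tsum_zero] at h
  simpa [trC] using h.norm

theorem TraceBounded.norm_tailProj_sq_le {e : HilbertBasis ℕ ℂ H} {D : H →L[ℂ] H}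
    (hD : TraceBounded e D) {c : ℝ} (hc : 0 ≤ c) {v : H}
    (hv : ∀ z, ‖⟪z, v⟫‖ ^ 2 ≤ c * (⟪z, D z⟫).re) (N : ℕ) :
    ‖tailProj e N v‖ ^ 2 ≤ c * ‖trC e (tailProj e N ∘L D)‖ := by
  have hleft : HasSum (fun i => ‖⟪e i, tailProj e N v⟫‖ ^ 2) (‖tailProj e N v‖ ^ 2) := by
    have h := Complex.hasSum_re (e.hasSum_inner_mul_inner (tailProj e N v) (tailProj e N v))
    convert h using 1
    · funext i
      rw [← inner_conj_symm, Complex.mul_conj, Complex.ofReal_re,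
        Complex.normSq_eq_norm_sq, RCLike.norm_conj]
    · exact (inner_self_eq_norm_sq (𝕜 := ℂ) _).symm
  have hright := (Complex.hasSum_re
    (hD.summable_norm (norm_tailProj_le e N)).of_norm.hasSum).mul_left c
  refine (hasSum_le (fun i => ?_) hleft hright).trans
    (mul_le_mul_of_nonneg_left (Complex.re_le_norm _) hc)
  rw [inner_tailProj, inner_tailProj]
  split_ifs
  · simp
  · exact hv _

end TraceEstimates

section Compactness

theorem totallyBounded_range_of_eventually_approx {E : Type*} [PseudoMetricSpace E] {u : ℕ → E}
    (h : ∀ ε > 0, ∃ T : Set E, TotallyBounded T ∧ ∀ᶠ n in atTop, ∃ t ∈ T, dist (u n) t < ε) :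
    TotallyBounded (Set.range u) := by
  refine Metric.totallyBounded_iff.2 fun ε hε => ?_
  obtain ⟨T, hT, hu⟩ := h (ε / 2) (half_pos hε)
  obtain ⟨F, hF, hTF⟩ := Metric.totallyBounded_iff.1 hT (ε / 2) (half_pos hε)
  obtain ⟨N, hN⟩ := eventually_atTop.1 hu
  refine ⟨F ∪ u '' Set.Iio N, hF.union ((Set.finite_Iio N).image u), ?_⟩
  rintro _ ⟨n, rfl⟩
  rcases lt_or_ge n N with hn | hn
  · exact Set.mem_biUnion (Or.inr ⟨n, hn, rfl⟩) (Metric.mem_ball_self hε)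
  · obtain ⟨t, ht, hut⟩ := hN n hn
    obtain ⟨f, hf, htf⟩ := Set.mem_iUnion₂.1 (hTF ht)
    refine Set.mem_biUnion (Or.inl hf) (Metric.mem_ball.2 ?_)
    linarith [dist_triangle (u n) t f, Metric.mem_ball.1 htf]

variable {H K : Type*} [NormedAddCommGroup H] [InnerProductSpace ℂ H]
  [NormedAddCommGroup K] [InnerProductSpace ℂ K]

theorem totallyBounded_range_apply_of_dense {A : ℕ → H →L[ℂ] K} (hA : ∀ n, ‖A n‖ ≤ 1)
    {S : Set H} (hS : Dense S) (h : ∀ x ∈ S, TotallyBounded (Set.range fun n => A n x)) (x : H) :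
    TotallyBounded (Set.range fun n => A n x) := by
  refine totallyBounded_range_of_eventually_approx fun ε hε => ?_
  obtain ⟨y, hy, hxy⟩ := hS.exists_dist_lt x hε
  refine ⟨_, h y hy, Eventually.of_forall fun n => ⟨A n y, ⟨n, rfl⟩, ?_⟩⟩
  rw [dist_eq_norm, ← map_sub]
  refine (((A n).le_of_opNorm_le (hA n) _).trans_eq (one_mul _)).trans_lt ?_
  rwa [← dist_eq_norm]

theorem cauchySeq_apply_of_dense {A : ℕ → H →L[ℂ] K} (hA : ∀ n, ‖A n‖ ≤ 1)
    {S : Set H} (hS : Dense S) (h : ∀ x ∈ S, CauchySeq fun n => A n x) (x : H) :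
    CauchySeq fun n => A n x := by
  refine Metric.cauchySeq_iff'.2 fun ε hε => ?_
  obtain ⟨y, hy, hxy⟩ := hS.exists_dist_lt x (show 0 < ε / 3 by positivity)
  obtain ⟨N, hN⟩ := Metric.cauchySeq_iff'.1 (h y hy) (ε / 3) (by positivity)
  have hAn (n : ℕ) : dist (A n x) (A n y) < ε / 3 := by
    rw [dist_eq_norm, ← map_sub]
    refine (((A n).le_of_opNorm_le (hA n) _).trans_eq (one_mul _)).trans_lt ?_
    rwa [← dist_eq_norm]
  refine ⟨N, fun n hn => ?_⟩
  have h1 := hAn N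
  rw [dist_comm] at h1
  linarith [dist_triangle4 (A n x) (A n y) (A N y) (A N x), hAn n, hN n hn]

theorem SOTRelCompact.of_totallyBounded [CompleteSpace H] [CompleteSpace K]
    (e : HilbertBasis ℕ ℂ H) {A : ℕ → H →L[ℂ] K} (hA : ∀ n, ‖A n‖ ≤ 1)
    (h : ∀ x, TotallyBounded (Set.range fun n => A n x)) : SOTRelCompact {B | ∃ n, B = A n} := by
  intro a ha
  choose m hm using ha
  obtain rfl : a = fun n => A (m n) := funext hm
  have hcpt : IsCompact (Set.univ.pi fun j => closure (Set.range fun n => A n (e j))) :=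
    isCompact_univ_pi fun j =>
      (h (e j)).closure.isCompact_of_isClosed isClosed_closure
  obtain ⟨L, -, k, hk, hL⟩ := hcpt.tendsto_subseq (x := fun n j => A (m n) (e j))
    fun n j _ => subset_closure ⟨m n, rfl⟩
  have hcauchy (x : H) : CauchySeq fun n => A (m (k n)) x := by
    refine cauchySeq_apply_of_dense (fun n => hA _)
      (Submodule.dense_iff_topologicalClosure_eq_top.2 e.dense_span) (fun x hx => ?_) x
    induction hx using Submodule.span_induction with
    | mem x hx =>
      obtain ⟨j, rfl⟩ := hx
      exact (tendsto_pi_nhds.1 hL j).cauchySeq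
    | zero => simpa using cauchySeq_const (0 : K)
    | add x y _ _ hx hy => simpa only [map_add] using! hx.add hy
    | smul c x _ hx =>
      simpa only [map_smul] using! (uniformContinuous_const_smul c).comp_cauchySeq hx
  choose g hg using fun x => cauchySeq_tendsto_of_complete (hcauchy x)
  exact ⟨k, continuousLinearMapOfTendsto _ (tendsto_pi_nhds.2 hg), hk, hg⟩

end Compactness

section TraceConvergence

variable {H K : Type*} [NormedAddCommGroup H] [InnerProductSpace ℂ H] [CompleteSpace H]
  [NormedAddCommGroup K] [InnerProductSpace ℂ K] [CompleteSpace K]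

theorem ContinuousLinearMap.IsPositive.dense_range {ρ : H →L[ℂ] H} (hρ : ρ.IsPositive)
    (hker : ∀ x, ρ x = 0 → x = 0) : Dense (Set.range ρ) := by
  change Dense (LinearMap.range (ρ : H →ₗ[ℂ] H) : Set H)
  rw [Submodule.dense_iff_topologicalClosure_eq_top,
    Submodule.topologicalClosure_eq_top_iff, Submodule.eq_bot_iff]
  refine fun x hx => hker x (inner_self_eq_zero (𝕜 := ℂ).1 ?_)
  rw [hρ.inner_left_eq_inner_right]
  exact Submodule.inner_left_of_mem_orthogonal (LinearMap.mem_range_self (ρ : H →ₗ[ℂ] H) (ρ x)) hx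

theorem TNConv.tendsto_apply {e : HilbertBasis ℕ ℂ H} {ρn : ℕ → H →L[ℂ] H} {ρ : H →L[ℂ] H}
    (h : TNConv e ρn ρ) (hρn : ∀ n, IsTC (ρn n)) (hρ : IsTC ρ) (x : H) :
    Tendsto (fun n => ρn n x) atTop (𝓝 (ρ x)) := by
  refine tendsto_iff_norm_sub_tendsto_zero.2 ?_
  refine squeeze_zero (fun n => norm_nonneg _)
    (fun n => (((hρn n).traceBounded e).sub (hρ.traceBounded e)).norm_apply_le x) ?_
  simpa using h.mul_const ‖x‖

theorem SOTConv.tendsto_inner_conj {A : ℕ → H →L[ℂ] K} {A₀ : H →L[ℂ] K} (h : SOTConv A A₀)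
    (hA : ∀ n, ‖A n‖ ≤ 1) {ρ : H →L[ℂ] H} (hρ : IsTC ρ) (x y : K) :
    Tendsto (fun n => ⟪x, A n (ρ (adjoint (A n) y))⟫) atTop
      (𝓝 ⟪x, A₀ (ρ (adjoint A₀ y))⟫) := by
  obtain ⟨f, g, hs, hρ⟩ := hρ
  have key (B : H →L[ℂ] K) :
      ∑' i, ⟪B (g i), y⟫ * ⟪x, B (f i)⟫ = ⟪x, B (ρ (adjoint B y))⟫ := by
    have hsum := (innerSL ℂ x).hasSum (B.hasSum (hρ (adjoint B y)))
    simp only [map_smul, innerSL_apply_apply, smul_eq_mul, adjoint_inner_right] at hsum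
    exact hsum.tsum_eq
  simp only [← key]
  refine tendsto_tsum_of_dominated_convergence (hs.mul_left (‖x‖ * ‖y‖)) (fun i => ?_)
    (Eventually.of_forall fun n i => ?_)
  · exact ((h (g i)).inner tendsto_const_nhds).mul (tendsto_const_nhds.inner (h (f i)))
  · have hAn (z : H) : ‖A n z‖ ≤ ‖z‖ := by simpa using (A n).le_of_opNorm_le (hA n) z
    calc ‖⟪A n (g i), y⟫ * ⟪x, A n (f i)⟫‖ ≤ (‖A n (g i)‖ * ‖y‖) * (‖x‖ * ‖A n (f i)‖) := by
          rw [norm_mul]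
          gcongr <;> exact norm_inner_le_norm _ _
      _ ≤ (‖g i‖ * ‖y‖) * (‖x‖ * ‖f i‖) := by
          gcongr <;> exact hAn _
      _ = ‖x‖ * ‖y‖ * (‖f i‖ * ‖g i‖) := by ring

/-- Each sequence `A n (ρ₀ y)` is totally bounded when `ρn n → ρ₀` and `A n ρn n (A n)*` converges
in the trace norm. -/
theorem totallyBounded_range_apply_of_tnConv {e : HilbertBasis ℕ ℂ H} {ρn : ℕ → H →L[ℂ] H}
    (hρn : ∀ n, IsPTC (ρn n)) {ρ₀ : H →L[ℂ] H} (hρ₀ : IsTC ρ₀) (hρconv : TNConv e ρn ρ₀)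
    {A : ℕ → H →L[ℂ] H} (hA : ∀ n, ‖A n‖ ≤ 1) {σ₀ : H →L[ℂ] H} (hσ₀ : IsTC σ₀)
    (hconv : TNConv e (fun n => A n ∘L ρn n ∘L adjoint (A n)) σ₀) (y : H) :
    TotallyBounded (Set.range fun n => A n (ρ₀ y)) := by
  have hAn (n : ℕ) (z : H) : ‖A n z‖ ≤ ‖z‖ := by simpa using (A n).le_of_opNorm_le (hA n) z
  have happly := hρconv.tendsto_apply (fun n => (hρn n).2) hρ₀ y
  have hdiff : Tendsto (fun n => ‖ρ₀ y - ρn n y‖) atTop (𝓝 0) := by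
    simpa using (tendsto_const_nhds (x := ρ₀ y).sub happly).norm
  obtain ⟨c, hc⟩ := ((tendsto_const_nhds (x := y)).inner happly (𝕜 := ℂ)).norm.bddAbove_range
  have hc (n : ℕ) : (⟪y, ρn n y⟫).re ≤ c := (Complex.re_le_norm _).trans (hc ⟨n, rfl⟩)
  have hc0 : 0 ≤ c := ((hρn 0).1.re_inner_nonneg_right y).trans (hc 0)
  set D : ℕ → H →L[ℂ] H := fun n => A n ∘L ρn n ∘L adjoint (A n)
  have hDb (n : ℕ) : TraceBounded e (D n) := ((hρn n).2.conj (A n)).traceBounded e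
  have hσb := hσ₀.traceBounded e
  have hbound (n : ℕ) (z : H) : ‖⟪z, A n (ρn n y)⟫‖ ^ 2 ≤ c * (⟪z, D n z⟫).re := by
    have h := (hρn n).1.norm_inner_apply_sq_le (adjoint (A n) z) y
    rw [adjoint_inner_left, adjoint_inner_left, mul_comm] at h
    refine h.trans (mul_le_mul_of_nonneg_right (hc n) ?_)
    exact ((hρn n).1.conj_adjoint (A n)).re_inner_nonneg_right z
  have htail (n N : ℕ) : ‖tailProj e N (A n (ρn n y))‖ ^ 2 ≤
      c * (tnorm e (D n - σ₀) + ‖trC e (tailProj e N ∘L σ₀)‖) := by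
    refine ((hDb n).norm_tailProj_sq_le hc0 (hbound n) N).trans
      (mul_le_mul_of_nonneg_left ?_ hc0)
    have hsub := ((hDb n).sub hσb).norm_trC_le (norm_tailProj_le e N)
    have heq : trC e (tailProj e N ∘L D n) =
        trC e (tailProj e N ∘L (D n - σ₀)) + trC e (tailProj e N ∘L σ₀) := by
      simp only [trC, comp_apply]
      rw [← Summable.tsum_add
        (((hDb n).sub hσb).summable_norm (norm_tailProj_le e N)).of_norm
        (hσb.summable_norm (norm_tailProj_le e N)).of_norm]
      simp
    rw [heq]
    exact (norm_add_le _ _).trans (add_le_add_left hsub _)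
  refine totallyBounded_range_of_eventually_approx fun ε hε => ?_
  have hN := (hσb.tendsto_trC_tailProj.const_mul c).eventually
    (gt_mem_nhds (show c * 0 < (ε / 2) ^ 2 / 2 by rw [mul_zero]; positivity))
  obtain ⟨N, hN⟩ := hN.exists
  set V := Submodule.span ℂ (e '' Set.Iio N)
  have : FiniteDimensional ℂ V := FiniteDimensional.span_of_finite ℂ ((Set.finite_Iio N).image e)
  refine ⟨V.subtypeL '' Metric.closedBall 0 ‖ρ₀ y‖,
    ((isCompact_closedBall (0 : V) _).image V.subtypeL.continuous).totallyBounded, ?_⟩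
  filter_upwards [hconv.eventually
      (gt_mem_nhds (show 0 < (ε / 2) ^ 2 / (2 * (c + 1)) by positivity)),
    hdiff.eventually (gt_mem_nhds (half_pos hε))] with n hn hn'
  refine ⟨V.starProjection (A n (ρ₀ y)), ⟨⟨_, V.starProjection_apply_mem _⟩, ?_, rfl⟩, ?_⟩
  · exact mem_closedBall_zero_iff.2 ((V.norm_starProjection_apply_le _).trans (hAn n _))
  · have hsplit : A n (ρ₀ y) - V.starProjection (A n (ρ₀ y)) =
        tailProj e N (A n (ρn n y)) + tailProj e N (A n (ρ₀ y - ρn n y)) := by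
      rw [← map_add, ← map_add, add_sub_cancel]
      exact (Submodule.starProjection_orthogonal_val _).symm
    rw [dist_eq_norm, hsplit]
    have h1 : ‖tailProj e N (A n (ρn n y))‖ < ε / 2 := by
      refine lt_of_pow_lt_pow_left₀ 2 (half_pos hε).le ((htail n N).trans_lt ?_)
      rw [lt_div_iff₀ (by positivity)] at hn
      have ht : 0 ≤ tnorm e (D n - σ₀) :=
        (norm_nonneg _).trans (((hDb n).sub hσb).norm_trC_le (norm_tailProj_le e N))
      linarith
    have h2 : ‖tailProj e N (A n (ρ₀ y - ρn n y))‖ ≤ ‖ρ₀ y - ρn n y‖ := by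
      refine le_trans ?_ (hAn n _)
      simpa using (tailProj e N).le_of_opNorm_le (norm_tailProj_le e N) (A n (ρ₀ y - ρn n y))
    linarith [norm_add_le (tailProj e N (A n (ρn n y))) (tailProj e N (A n (ρ₀ y - ρn n y)))]

end TraceConvergence

section Statement

variable {H : Type*} [NormedAddCommGroup H] [InnerProductSpace ℂ H] [CompleteSpace H]

/-- If `ρ_n → ρ₀` in the trace norm with `ρ₀` a faithful state, `‖A_n‖ ≤ 1` and
`A_n ρ_n A_n* → σ₀ ∈ T₊(H)` in the trace norm, then `{A_n}` is relatively compact in the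
strong operator topology and every partial limit `A₀` satisfies `A₀ ρ₀ A₀* = σ₀`. -/
theorem contractions_relative_compactness
    (e : HilbertBasis ℕ ℂ H)
    (ρn : ℕ → H →L[ℂ] H) (hρn : ∀ n, IsPTC (ρn n))
    (ρ₀ : H →L[ℂ] H) (hρ₀ : IsFaithfulState e ρ₀)
    (hρconv : TNConv e ρn ρ₀)
    (A : ℕ → H →L[ℂ] H) (hA : ∀ n, ‖A n‖ ≤ 1)
    (σ₀ : H →L[ℂ] H) (hσ₀ : IsPTC σ₀)
    (hconv : Tendsto (fun n =>
      tnorm e (A n ∘L ρn n ∘L ContinuousLinearMap.adjoint (A n) - σ₀)) atTop (nhds 0)) :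
    SOTRelCompact {B | ∃ n, B = A n} ∧
    ∀ (A₀ : H →L[ℂ] H) (k : ℕ → ℕ), StrictMono k → SOTConv (fun j => A (k j)) A₀ →
      A₀ ∘L ρ₀ ∘L ContinuousLinearMap.adjoint A₀ = σ₀ := by
  constructor
  · refine SOTRelCompact.of_totallyBounded e hA (totallyBounded_range_apply_of_dense hA
      (hρ₀.1.1.dense_range hρ₀.2) ?_)
    rintro _ ⟨y, rfl⟩
    exact totallyBounded_range_apply_of_tnConv hρn hρ₀.1.2.1 hρconv hA hσ₀.2 hconv y
  · intro A₀ k hk hA₀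
    refine ext fun y => ext_inner_left ℂ fun x => ?_
    have hlim := hA₀.tendsto_inner_conj (fun j => hA (k j)) hρ₀.1.2.1 x y
    have hσ : Tendsto (fun j => ⟪x, A (k j) (ρn (k j) (adjoint (A (k j)) y))⟫) atTop
        (𝓝 ⟪x, σ₀ y⟫) :=
      tendsto_const_nhds.inner ((TNConv.tendsto_apply hconv
        (fun n => (hρn n).2.conj (A n)) hσ₀.2 y).comp hk.tendsto_atTop)
    have hbound (n : ℕ) : ‖⟪x, A n (ρn n (adjoint (A n) y))⟫ - ⟪x, A n (ρ₀ (adjoint (A n) y))⟫‖ ≤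
        tnorm e (ρn n - ρ₀) * (‖x‖ * ‖y‖) := by
      have hb := ((hρn n).2.traceBounded e).sub (hρ₀.1.2.1.traceBounded e)
      have hadj (z : H) : ‖adjoint (A n) z‖ ≤ ‖z‖ := by
        simpa using (adjoint (A n)).le_of_opNorm_le ((adjoint.norm_map (A n)).trans_le (hA n)) z
      rw [← inner_sub_right, ← map_sub, ← sub_apply, ← adjoint_inner_left]
      refine (hb.norm_inner_le _ _).trans ?_
      have ht := (norm_nonneg _).trans (hb.norm_trC_le (B := 0) (by simp))
      gcongr <;> exact hadj _
    have hdiff := (squeeze_zero_norm hbound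
      (by simpa using hρconv.mul_const (‖x‖ * ‖y‖))).comp hk.tendsto_atTop
    have hlim' := hσ.sub hdiff
    simp only [Function.comp_apply, sub_sub_cancel, sub_zero] at hlim'
    exact tendsto_nhds_unique hlim hlim'

end Statement
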